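/- arXiv:2212.11239 — 4 statements merged into one kernel-verified Lean document; each statement's English description precedes it below -/
import Mathlib

section
/- Let G = (V,E) be a hypergraph, let v be a nest point of G, and let e_1 ⊂ e_2 ⊂ ⋯ ⊂ e_k be the edges of G containing v. For each i ∈ [k] := {1,…,k}, let p_i := e_i \ {v}, let E_v := {e_1,…,e_k}, and let P_v := { p ∈ {p_1,…,p_k} : |p| ≥ 2 }. Assume P_v ⊆ E. Let G_1 := (e_k, E_v ∪ P_v) and let G_2 := G − v. Then the multilinear set S_G is decomposable into S_{G_1} and S_{G_2}; that is, conv S_G = conv S̄_{G_1} ∩ conv S̄_{G_2}. -/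
open BigOperators

variable {α : Type*} [DecidableEq α]

/-- `(V, E)` forms a hypergraph: every edge is a subset of `V` of cardinality at least two. -/
def IsHypergraph (V : Finset α) (E : Finset (Finset α)) : Prop :=
  (∀ e ∈ E, e ⊆ V) ∧ ∀ e ∈ E, 2 ≤ e.card

/-- The multilinear set `S_G` of the hypergraph `G = (V, E)`, viewed inside the space of all
functions on node- and edge-coordinates, with all coordinates outside `V ∪ E` set to zero. -/
def mSet (V : Finset α) (E : Finset (Finset α)) : Set ((α ⊕ Finset α) → ℝ) :=
  { z | (∀ v ∈ V, z (Sum.inl v) = 0 ∨ z (Sum.inl v) = 1)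
      ∧ (∀ v, v ∉ V → z (Sum.inl v) = 0)
      ∧ (∀ e, e ∉ E → z (Sum.inr e) = 0)
      ∧ ∀ e ∈ E, z (Sum.inr e) = ∏ v ∈ e, z (Sum.inl v) }

/-- `S̄_H` for a hypergraph `H` with edge set `E₁`, inside the ambient space `{0,1}^{V ∪ E}`:
the binary points of the ambient hypergraph `(V, E)` whose restriction to the coordinates of
`H` lies in `S_H`. -/
def barSet (V : Finset α) (E E₁ : Finset (Finset α)) : Set ((α ⊕ Finset α) → ℝ) :=
  { z | (∀ v ∈ V, z (Sum.inl v) = 0 ∨ z (Sum.inl v) = 1)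
      ∧ (∀ e ∈ E, z (Sum.inr e) = 0 ∨ z (Sum.inr e) = 1)
      ∧ (∀ v, v ∉ V → z (Sum.inl v) = 0)
      ∧ (∀ e, e ∉ E → z (Sum.inr e) = 0)
      ∧ ∀ e ∈ E₁, z (Sum.inr e) = ∏ v ∈ e, z (Sum.inl v) }

/-- The variable `z_p`: the edge variable if `|p| ≥ 2`, the node variable `z_u` if `p = {u}`,
and `0` if `p = ∅`. -/
def zc (z : (α ⊕ Finset α) → ℝ) (p : Finset α) : ℝ :=
  if 2 ≤ p.card then z (Sum.inr p) else ∑ u ∈ p, z (Sum.inl u)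

/-- `v` is a nest point of `(V, E)`: the edges containing `v` are totally ordered by
inclusion. -/
def IsNestPoint (V : Finset α) (E : Finset (Finset α)) (v : α) : Prop :=
  v ∈ V ∧ ∀ e ∈ E, v ∈ e → ∀ f ∈ E, v ∈ f → e ⊆ f ∨ f ⊆ e

/-- Edge set of the hypergraph `G - v` obtained by removing the node `v`. -/
def eraseE (E : Finset (Finset α)) (v : α) : Finset (Finset α) :=
  (E.image fun e => e.erase v).filter fun p => 2 ≤ p.card

/-- Node set after removing a list of nodes. -/
def eraseListV (V : Finset α) (l : List α) : Finset α := l.foldl Finset.erase V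

/-- Edge set after removing a list of nodes. -/
def eraseListE (E : Finset (Finset α)) (l : List α) : Finset (Finset α) := l.foldl eraseE E

/-- `l` is a nest point sequence of `(V, E)`. -/
def IsNestPointSeq (V : Finset α) (E : Finset (Finset α)) (l : List α) : Prop :=
  l.Nodup ∧ ∀ i : Fin l.length,
    IsNestPoint (eraseListV V (l.take i.1)) (eraseListE E (l.take i.1)) (l.get i)

/-- `(V, E)` is expanded w.r.t. the sequence `l`. -/
def IsExpanded (V : Finset α) (E : Finset (Finset α)) (l : List α) : Prop :=
  IsNestPointSeq V E l ∧
    ∀ e ∈ E, ∀ i ≤ l.length, 2 ≤ (e \ (l.take i).toFinset).card →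
      e \ (l.take i).toFinset ∈ E

/-- Edge set of the expansion of `(V, E)` w.r.t. `l`. -/
def expansionE (E : Finset (Finset α)) (l : List α) : Finset (Finset α) :=
  E ∪ E.biUnion fun e =>
    ((Finset.range l.length).image fun i => e \ (l.take (i + 1)).toFinset).filter
      fun p => 2 ≤ p.card

/-- The hypergraph with edge set `E` contains a β-cycle (of length `t + 3 ≥ 3`). -/
def HasBetaCycle (E : Finset (Finset α)) : Prop :=
  ∃ t : ℕ, ∃ v : Fin (t + 3) → α, ∃ e : Fin (t + 3) → Finset α,
    Function.Injective v ∧ Function.Injective e ∧ (∀ i, e i ∈ E) ∧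
      ∀ i j : Fin (t + 3), v i ∈ e j ↔ (j = i ∨ j = i - 1)

/-- The hypergraph with edge set `E` is β-acyclic. -/
def IsBetaAcyclic (E : Finset (Finset α)) : Prop := ¬ HasBetaCycle E

/-- The product `a · z` over the coordinates indexed by `V ∪ E`. -/
def dotp (V : Finset α) (E : Finset (Finset α)) (a z : (α ⊕ Finset α) → ℝ) : ℝ :=
  (∑ u ∈ V, a (Sum.inl u) * z (Sum.inl u)) + ∑ f ∈ E, a (Sum.inr f) * z (Sum.inr f)

/-- The inequality `a · z ≤ b` is valid for the multilinear polytope of `(V, E)`. -/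
def IsValidIneq (V : Finset α) (E : Finset (Finset α)) (a : (α ⊕ Finset α) → ℝ)
    (b : ℝ) : Prop :=
  ∀ z ∈ convexHull ℝ (mSet V E), dotp V E a z ≤ b

/-- The inequality `a · z ≤ b` defines a facet of the multilinear polytope of `(V, E)`:
it is valid and the face it induces has affine dimension `|V| + |E| - 1`. -/
def IsFacetIneq (V : Finset α) (E : Finset (Finset α)) (a : (α ⊕ Finset α) → ℝ)
    (b : ℝ) : Prop :=
  IsValidIneq V E a b ∧
    Module.finrank ℝ
        (affineSpan ℝ {z ∈ convexHull ℝ (mSet V E) | dotp V E a z = b}).direction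
      = V.card + E.card - 1

/-- Restriction of a point to the coordinates indexed by `V' ∪ E'` (zero elsewhere). -/
def restrictTo (V' : Finset α) (E' : Finset (Finset α)) (z : (α ⊕ Finset α) → ℝ) :
    (α ⊕ Finset α) → ℝ
  | Sum.inl u => if u ∈ V' then z (Sum.inl u) else 0
  | Sum.inr f => if f ∈ E' then z (Sum.inr f) else 0

/-- The set `N(p_j) = p_j ∩ (⋃_{i < j} p_i)` induced by a running intersection ordering. -/
def Nfun {m : ℕ} (p : Fin m → Finset α) (j : Fin m) : Finset α :=
  p j ∩ (Finset.univ.filter fun i => i < j).biUnion p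

/-- The standard linearization `MP^LP` of `(V, E)` (with coordinates outside `V ∪ E` set to
zero). -/
def stdLin (V : Finset α) (E : Finset (Finset α)) : Set ((α ⊕ Finset α) → ℝ) :=
  { z | (∀ v, v ∉ V → z (Sum.inl v) = 0)
      ∧ (∀ e, e ∉ E → z (Sum.inr e) = 0)
      ∧ (∀ v ∈ V, z (Sum.inl v) ≤ 1)
      ∧ ∀ e ∈ E, 0 ≤ z (Sum.inr e)
          ∧ (∑ v ∈ e, z (Sum.inl v)) - (e.card : ℝ) + 1 ≤ z (Sum.inr e)
          ∧ ∀ v ∈ e, z (Sum.inr e) ≤ z (Sum.inl v) }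

/-- `S` is the half-space of an extended running intersection inequality of `(V, E)`. -/
def IsERIHalfspace (V : Finset α) (E : Finset (Finset α))
    (S : Set ((α ⊕ Finset α) → ℝ)) : Prop :=
  ∃ (t m : ℕ) (e₀ : Finset α) (eK : Fin t → Finset α) (p : Fin m → Finset α)
      (idx : Fin t → Fin m) (w : Fin t → Finset α),
    e₀ ∈ E ∧ (∀ k, eK k ∈ E) ∧ (∀ k, (e₀ ∩ eK k).Nonempty) ∧
      Function.Injective p ∧ (∀ j, ∃ k, p j = e₀ ∩ eK k) ∧
      (∀ k, p (idx k) = e₀ ∩ eK k) ∧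
      (∀ j : Fin m, 0 < (j : ℕ) → ∃ j' : Fin m, j' < j ∧ Nfun p j ⊆ p j') ∧
      (∀ k, w k ⊆ Nfun p (idx k) ∧ (w k = ∅ ∨ (∃ u ∈ V, w k = {u}) ∨ w k ∈ E)) ∧
      S = { z | - (∑ k : Fin t, zc z (w k))
            + (∑ u ∈ e₀ \ Finset.univ.biUnion eK, z (Sum.inl u))
            + (∑ k : Fin t, z (Sum.inr (eK k))) - z (Sum.inr e₀)
          ≤ ((e₀ \ Finset.univ.biUnion eK).card : ℝ)
            + ((Finset.univ.filter fun k : Fin t => Nfun p (idx k) = ∅).card : ℝ) - 1 }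

/-- The extended running intersection relaxation `MP^ERI` of `(V, E)`. -/
def MPERI (V : Finset α) (E : Finset (Finset α)) : Set ((α ⊕ Finset α) → ℝ) :=
  stdLin V E ∩ ⋂₀ { S | IsERIHalfspace V E S }

/-- If two weight families have the same total and the same mass strictly above every level, they
have the same mass at every level. -/
lemma sum_level_eq_of_tail_eq {ι κ : Type*} [Fintype ι] [Fintype κ] {w : ι → ℝ} {u : κ → ℝ}
    {m : ι → ℕ} {n : κ → ℕ} (htot : ∑ i, w i = ∑ j, u j)
    (htail : ∀ t, ∑ i, (if t < m i then w i else 0) = ∑ j, (if t < n j then u j else 0)) (t : ℕ) :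
    ∑ i, (if m i = t then w i else 0) = ∑ j, (if n j = t then u j else 0) := by
  have hle : ∑ i, (if t ≤ m i then w i else 0) = ∑ j, (if t ≤ n j then u j else 0) := by
    cases t with
    | zero => simpa using htot
    | succ t => exact htail t
  have hsplit : ∀ (a : ℕ) (r : ℝ),
      (if a = t then r else 0) = (if t ≤ a then r else 0) - (if t < a then r else 0) := by
    intro a r
    rcases lt_trichotomy a t with h | h | h
    · simp [h.ne, h.not_ge, h.le]
    · simp [h]
    · simp [h.ne', h, h.le]
  simp only [hsplit, Finset.sum_sub_distrib, hle, htail t]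

/-- Two nonnegative weight families with the same mass at every label admit a coupling supported
on pairs with equal labels. -/
lemma exists_label_coupling {ι κ β : Type*} [Fintype ι] [Fintype κ] [DecidableEq β]
    {w : ι → ℝ} {u : κ → ℝ} (hw : ∀ i, 0 ≤ w i) (hu : ∀ j, 0 ≤ u j) {m : ι → β} {n : κ → β}
    (hmass : ∀ t, ∑ i, (if m i = t then w i else 0) = ∑ j, (if n j = t then u j else 0)) :
    ∃ c : ι → κ → ℝ, (∀ i j, 0 ≤ c i j) ∧ (∀ i j, c i j ≠ 0 → m i = n j) ∧
      (∀ i, ∑ j, c i j = w i) ∧ ∀ j, ∑ i, c i j = u j := by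
  set mass : β → ℝ := fun t => ∑ i, (if m i = t then w i else 0) with hmass_def
  have hmass_nonneg : ∀ t, 0 ≤ mass t := fun t =>
    Finset.sum_nonneg fun i _ => by split_ifs <;> simp [hw]
  refine ⟨fun i j => if m i = n j then w i * u j / mass (m i) else 0, ?_, ?_, ?_, ?_⟩
  · intro i j
    dsimp only
    split_ifs
    · exact div_nonneg (mul_nonneg (hw i) (hu j)) (hmass_nonneg _)
    · exact le_rfl
  · intro i j h
    by_contra hne
    exact h (if_neg hne)
  · intro i
    have hsum : ∑ j, (if m i = n j then w i * u j / mass (m i) else 0)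
        = w i / mass (m i) * mass (m i) := by
      nth_rewrite 3 [hmass_def]
      simp only [hmass, Finset.mul_sum]
      refine Finset.sum_congr rfl fun j _ => ?_
      simp only [eq_comm (a := n j)]
      split_ifs
      · ring
      · simp
    rw [hsum]
    refine div_mul_cancel_of_imp fun h => ?_
    have := (Finset.sum_eq_zero_iff_of_nonneg
      (fun i' _ => by split_ifs <;> simp [hw])).1 h i (Finset.mem_univ i)
    simpa using this
  · intro j
    have hsum : ∑ i, (if m i = n j then w i * u j / mass (m i) else 0)
        = u j / mass (n j) * mass (n j) := by
      conv_rhs => rw [hmass_def]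
      simp only [Finset.mul_sum]
      refine Finset.sum_congr rfl fun i _ => ?_
      split_ifs with h
      · rw [h]; ring
      · simp
    rw [hsum]
    refine div_mul_cancel_of_imp fun h => ?_
    have h' : ∑ j', (if n j' = n j then u j' else 0) = 0 := (hmass (n j)).symm.trans h
    have := (Finset.sum_eq_zero_iff_of_nonneg
      (fun j' _ => by split_ifs <;> simp [hu])).1 h' j (Finset.mem_univ j)
    simpa using this

/-- The point agreeing with `x` on the node `v` and the edges containing it, and with `y`
elsewhere. -/
def glueAt (v : α) (x y : (α ⊕ Finset α) → ℝ) : (α ⊕ Finset α) → ℝ :=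
  Sum.elim (fun u => if u = v then x (Sum.inl u) else y (Sum.inl u))
    (fun f => if v ∈ f then x (Sum.inr f) else y (Sum.inr f))

lemma zc_sum {γ ι : Type*} [Fintype ι] (w : ι → ℝ) (x : ι → (γ ⊕ Finset γ) → ℝ) (p : Finset γ) :
    zc (∑ i, w i • x i) p = ∑ i, w i * zc (x i) p := by
  unfold zc
  split_ifs
  · simp
  · simp only [Finset.sum_apply, Pi.smul_apply, smul_eq_mul, Finset.mul_sum]
    exact Finset.sum_comm

lemma zc_eq_prod {γ : Type*} {x : (γ ⊕ Finset γ) → ℝ} {p : Finset γ} (hp : p.Nonempty)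
    (hx : 2 ≤ p.card → x (Sum.inr p) = ∏ u ∈ p, x (Sum.inl u)) :
    zc x p = ∏ u ∈ p, x (Sum.inl u) := by
  unfold zc
  split_ifs with h
  · exact hx h
  · obtain ⟨u, rfl⟩ := Finset.card_eq_one.1
      (show p.card = 1 by have := hp.card_pos; omega)
    simp

/-- The number of leading ones of a `0/1` sequence that is a run of ones followed by zeros. -/
noncomputable def chainLevel {k : ℕ} (q : Fin k → ℝ) : ℕ :=
  (Finset.univ.filter fun i => q i = 1).sup fun i => (i : ℕ) + 1

lemma lt_chainLevel_iff {k : ℕ} {q : Fin k → ℝ} (hq : ∀ i j, i ≤ j → q j = 1 → q i = 1)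
    (i : Fin k) : (i : ℕ) < chainLevel q ↔ q i = 1 := by
  unfold chainLevel
  rw [Finset.lt_sup_iff]
  constructor
  · rintro ⟨j, hj, hij⟩
    exact hq i j (Fin.le_def.2 (by omega)) (by simpa using hj)
  · exact fun h => ⟨i, by simpa using h, by omega⟩

lemma chainLevel_le {k : ℕ} (q : Fin k → ℝ) : chainLevel q ≤ k :=
  Finset.sup_le fun i _ => i.2

/-- On a chain of nonempty node sets, products of `0/1` node values are `0/1`, and a product equal
to one forces all smaller ones to equal one. -/
lemma zc_chain {γ : Type*} {V : Finset γ} {k : ℕ} {p : Fin k → Finset γ} (hpV : ∀ i, p i ⊆ V)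
    (hmono : Monotone p) {x : (γ ⊕ Finset γ) → ℝ}
    (hx : ∀ u ∈ V, x (Sum.inl u) = 0 ∨ x (Sum.inl u) = 1)
    (hprod : ∀ i, zc x (p i) = ∏ u ∈ p i, x (Sum.inl u)) :
    (∀ i, zc x (p i) = 0 ∨ zc x (p i) = 1) ∧
      ∀ i j, i ≤ j → zc x (p j) = 1 → zc x (p i) = 1 := by
  have hbin : ∀ i, zc x (p i) = 0 ∨ ∀ u ∈ p i, x (Sum.inl u) = 1 := by
    intro i
    rw [hprod, or_iff_not_imp_left, Finset.prod_eq_zero_iff]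
    intro h u hu
    exact (hx u (hpV i hu)).resolve_left fun h0 => h ⟨u, hu, h0⟩
  refine ⟨fun i => (hbin i).imp_right fun h => ?_, fun i j hij h1 => ?_⟩
  · rw [hprod, Finset.prod_congr rfl h, Finset.prod_const_one]
  · have h := (hbin j).resolve_left (by rw [h1]; exact one_ne_zero)
    rw [hprod, Finset.prod_congr rfl fun u hu => h u (hmono hij hu), Finset.prod_const_one]

/-- decomposition of the multilinear set at a nest point. -/
theorem multilinear_set_decomposition
    (V : Finset α) (E : Finset (Finset α)) (hG : IsHypergraph V E)
    (v : α) (hv : IsNestPoint V E v)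
    (k : ℕ) (hk : 1 ≤ k) (e : Fin k → Finset α)
    (hchain : ∀ i j : Fin k, i < j → e i ⊂ e j)
    (hEv : ∀ f : Finset α, (f ∈ E ∧ v ∈ f) ↔ ∃ i, f = e i)
    (hPv : ∀ i : Fin k, 2 ≤ ((e i).erase v).card → (e i).erase v ∈ E) :
    convexHull ℝ (mSet V E) =
      convexHull ℝ (barSet V E
          (Finset.univ.image e ∪
            (Finset.univ.image fun i => (e i).erase v).filter fun p => 2 ≤ p.card)) ∩
        convexHull ℝ (barSet V E (eraseE E v)) := by
  set p : Fin k → Finset α := fun i => (e i).erase v with hp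
  set E₁ := Finset.univ.image e ∪ (Finset.univ.image p).filter fun q => 2 ≤ q.card with hE₁
  have heE : ∀ i, e i ∈ E ∧ v ∈ e i := fun i => (hEv (e i)).2 ⟨i, rfl⟩
  have hpV : ∀ i, p i ⊆ V := fun i => (Finset.erase_subset _ _).trans (hG.1 _ (heE i).1)
  have hpne : ∀ i, (p i).Nonempty := by
    intro i
    rw [← Finset.card_pos, hp]
    have := hG.2 _ (heE i).1
    simp only [Finset.card_erase_of_mem (heE i).2]
    omega
  have hmono : Monotone p := by
    intro i j hij
    rcases hij.eq_or_lt with rfl | h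
    · exact le_rfl
    · exact Finset.erase_subset_erase v (hchain i j h).1
  have hE₁E : E₁ ⊆ E := by
    intro f hf
    simp only [hE₁, Finset.mem_union, Finset.mem_image, Finset.mem_filter, Finset.mem_univ,
      true_and] at hf
    rcases hf with ⟨i, rfl⟩ | ⟨⟨i, rfl⟩, h⟩
    · exact (heE i).1
    · exact hPv i h
  have hE₂E : eraseE E v ⊆ E := by
    intro f hf
    simp only [eraseE, Finset.mem_filter, Finset.mem_image] at hf
    obtain ⟨⟨g, hg, rfl⟩, h⟩ := hf
    by_cases hvg : v ∈ g
    · obtain ⟨i, rfl⟩ := (hEv g).1 ⟨hg, hvg⟩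
      exact hPv i h
    · rwa [Finset.erase_eq_of_notMem hvg]
  have hbin : ∀ z ∈ mSet V E, ∀ f ∈ E, z (Sum.inr f) = 0 ∨ z (Sum.inr f) = 1 := by
    intro z hz f hf
    rw [hz.2.2.2 f hf, or_iff_not_imp_left, Finset.prod_eq_zero_iff]
    exact fun h => Finset.prod_eq_one fun u hu =>
      (hz.1 u (hG.1 f hf hu)).resolve_left fun h0 => h ⟨u, hu, h0⟩
  have hsub : ∀ F ⊆ E, mSet V E ⊆ barSet V E F := fun F hF z hz =>
    ⟨hz.1, hbin z hz, hz.2.1, hz.2.2.1, fun f hf => hz.2.2.2 f (hF hf)⟩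
  refine Set.Subset.antisymm
    (Set.subset_inter (convexHull_mono (hsub _ hE₁E)) (convexHull_mono (hsub _ hE₂E))) ?_
  rintro z ⟨hz₁, hz₂⟩
  obtain ⟨ι, _, w, x, hw, hw1, hx, hxz⟩ := mem_convexHull_iff_exists_fintype.1 hz₁
  obtain ⟨κ, _, u, y, hu, hu1, hy, hyz⟩ := mem_convexHull_iff_exists_fintype.1 hz₂
  have hxp : ∀ a i, zc (x a) (p i) = ∏ b ∈ p i, x a (Sum.inl b) := fun a i =>
    zc_eq_prod (hpne i) fun h => (hx a).2.2.2.2 _ (Finset.mem_union_right _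
      (Finset.mem_filter.2 ⟨Finset.mem_image_of_mem _ (Finset.mem_univ i), h⟩))
  have hyp : ∀ a i, zc (y a) (p i) = ∏ b ∈ p i, y a (Sum.inl b) := fun a i =>
    zc_eq_prod (hpne i) fun h => (hy a).2.2.2.2 _
      (Finset.mem_filter.2 ⟨Finset.mem_image_of_mem _ (heE i).1, h⟩)
  have hxc := fun a => zc_chain hpV hmono (hx a).1 (hxp a)
  have hyc := fun a => zc_chain hpV hmono (hy a).1 (hyp a)
  set m : ι → ℕ := fun a => chainLevel fun i => zc (x a) (p i) with hm
  set n : κ → ℕ := fun a => chainLevel fun i => zc (y a) (p i) with hn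
  have hmx : ∀ a (i : Fin k), (i : ℕ) < m a ↔ zc (x a) (p i) = 1 := fun a =>
    lt_chainLevel_iff (hxc a).2
  have hny : ∀ a (i : Fin k), (i : ℕ) < n a ↔ zc (y a) (p i) = 1 := fun a =>
    lt_chainLevel_iff (hyc a).2
  have htail : ∀ t, ∑ a, (if t < m a then w a else 0) = ∑ a, (if t < n a then u a else 0) := by
    intro t
    by_cases ht : t < k
    · have h₁ : zc z (p ⟨t, ht⟩) = ∑ a, (if t < m a then w a else 0) := by
        rw [← hxz, zc_sum]
        refine Finset.sum_congr rfl fun a _ => ?_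
        have := hmx a ⟨t, ht⟩
        rcases (hxc a).1 ⟨t, ht⟩ with h | h <;> simp_all
      have h₂ : zc z (p ⟨t, ht⟩) = ∑ a, (if t < n a then u a else 0) := by
        rw [← hyz, zc_sum]
        refine Finset.sum_congr rfl fun a _ => ?_
        have := hny a ⟨t, ht⟩
        rcases (hyc a).1 ⟨t, ht⟩ with h | h <;> simp_all
      exact h₁.symm.trans h₂
    · have h₁ : ∀ a, ¬ t < m a := fun a h => ht (h.trans_le (chainLevel_le _))
      have h₂ : ∀ a, ¬ t < n a := fun a h => ht (h.trans_le (chainLevel_le _))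
      simp only [h₁, h₂, if_false, Finset.sum_const_zero]
  obtain ⟨c, hc0, hcl, hcw, hcu⟩ :=
    exists_label_coupling hw hu (sum_level_eq_of_tail_eq (hw1.trans hu1.symm) htail)
  have hmem : ∀ a b, m a = n b → glueAt v (x a) (y b) ∈ mSet V E := by
    intro a b hab
    have hzc : ∀ i, zc (x a) (p i) = zc (y b) (p i) := by
      intro i
      have h : zc (x a) (p i) = 1 ↔ zc (y b) (p i) = 1 := by rw [← hmx, ← hny, hab]
      rcases (hxc a).1 i with h1 | h1 <;> rcases (hyc b).1 i with h2 | h2 <;> simp_all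
    refine ⟨fun s hs => ?_, fun s hs => ?_, fun f hf => ?_, fun f hf => ?_⟩
    · by_cases h : s = v
      · simpa [glueAt, h] using (hx a).1 v hv.1
      · simpa [glueAt, h] using (hy b).1 s hs
    · have h : s ≠ v := fun h => hs (h ▸ hv.1)
      simpa [glueAt, h] using (hy b).2.2.1 s hs
    · by_cases h : v ∈ f
      · simpa [glueAt, h] using (hx a).2.2.2.1 f hf
      · simpa [glueAt, h] using (hy b).2.2.2.1 f hf
    · have hrest : ∀ g : Finset α, v ∉ g →
          ∏ s ∈ g, glueAt v (x a) (y b) (Sum.inl s) = ∏ s ∈ g, y b (Sum.inl s) :=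
        fun g hg => Finset.prod_congr rfl fun s hs => if_neg fun (h : s = v) => hg (h ▸ hs)
      by_cases h : v ∈ f
      · obtain ⟨i, rfl⟩ := (hEv f).1 ⟨hf, h⟩
        rw [← Finset.mul_prod_erase _ _ h, hrest _ (Finset.notMem_erase v _), ← hyp b i, ← hzc i,
          hxp a i]
        simp only [glueAt, Sum.elim_inr, Sum.elim_inl, if_pos h, if_true]
        rw [(hx a).2.2.2.2 (e i) (Finset.mem_union_left _
          (Finset.mem_image_of_mem _ (Finset.mem_univ i))), ← Finset.mul_prod_erase _ _ h]
      · rw [hrest f h]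
        simp only [glueAt, Sum.elim_inr, if_neg h]
        exact (hy b).2.2.2.2 f (Finset.mem_filter.2
          ⟨Finset.mem_image.2 ⟨f, hf, Finset.erase_eq_of_notMem h⟩, hG.2 f hf⟩)
  have hxcoord : ∀ s, ∑ a, ∑ b, c a b * x a s = z s := by
    intro s
    simp only [← Finset.sum_mul, hcw, ← hxz, Finset.sum_apply, Pi.smul_apply, smul_eq_mul]
  have hycoord : ∀ s, ∑ a, ∑ b, c a b * y b s = z s := by
    intro s
    rw [Finset.sum_comm]
    simp only [← Finset.sum_mul, hcu, ← hyz, Finset.sum_apply, Pi.smul_apply, smul_eq_mul]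
  have hzsum : ∑ ab : ι × κ, c ab.1 ab.2 • glueAt v (x ab.1) (y ab.2) = z := by
    funext s
    simp only [Fintype.sum_prod_type, Finset.sum_apply, Pi.smul_apply, smul_eq_mul]
    rcases s with s | f
    · by_cases h : s = v
      · simpa [glueAt, h] using hxcoord (Sum.inl v)
      · simpa [glueAt, h] using hycoord (Sum.inl s)
    · by_cases h : v ∈ f
      · simpa [glueAt, h] using hxcoord (Sum.inr f)
      · simpa [glueAt, h] using hycoord (Sum.inr f)
  rw [← hzsum, ← finsum_eq_sum_of_fintype]
  refine (convex_convexHull ℝ _).finsum_mem (fun ab => hc0 ab.1 ab.2) ?_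
    fun ab hab => subset_convexHull ℝ _ (hmem _ _ (hcl _ _ hab))
  rw [finsum_eq_sum_of_fintype, Fintype.sum_prod_type]
  simp only [hcw, hw1]
end

section
/- Let G = (V,E) be a hypergraph, let v be a nest point of G with edges e_1 ⊂ e_2 ⊂ ⋯ ⊂ e_k containing v, let p_i := e_i \ {v} for i ∈ [k], E_v := {e_1,…,e_k}, P_v := { p ∈ {p_1,…,p_k} : |p| ≥ 2 }, and assume P_v ⊆ E, so that G = G_1 ∪ G_2 where G_1 := (e_k, E_v ∪ P_v) and G_2 := G − v. Let z ∈ S_{G_1} and z' ∈ S_{G_2} be such that z_{p_i} = z'_{p_i} for every i ∈ [k] (where for |p_i| = 1 this refers to the corresponding node variable). Then the point of {0,1}^{V ∪ E} that agrees with z on the coordinates of v and of e_1,…,e_k, and agrees with z' on all remaining coordinates, belongs to S_G. -/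
open BigOperators

variable {α : Type*} [DecidableEq α]

theorem eraseE_subset {E : Finset (Finset α)} {v : α}
    (hE : ∀ f ∈ E, v ∈ f → 2 ≤ (f.erase v).card → f.erase v ∈ E) : eraseE E v ⊆ E := by
  intro p hp
  obtain ⟨hp, hcard⟩ := Finset.mem_filter.1 hp
  obtain ⟨f, hf, rfl⟩ := Finset.mem_image.1 hp
  by_cases hvf : v ∈ f
  · exact hE f hf hvf hcard
  · simpa [Finset.erase_eq_of_notMem hvf] using hf

theorem erase_mem_eraseE {E : Finset (Finset α)} {v : α} {f : Finset α} (hf : f ∈ E)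
    (hcard : 2 ≤ (f.erase v).card) : f.erase v ∈ eraseE E v :=
  Finset.mem_filter.2 ⟨Finset.mem_image_of_mem _ hf, hcard⟩

omit [DecidableEq α] in
theorem zc_eq_prod_s1 {V : Finset α} {E : Finset (Finset α)} {z : (α ⊕ Finset α) → ℝ}
    (hz : z ∈ mSet V E) {p : Finset α} (hp : p.Nonempty) (hpE : 2 ≤ p.card → p ∈ E) :
    zc z p = ∏ u ∈ p, z (Sum.inl u) := by
  unfold zc
  split_ifs with h
  · exact hz.2.2.2 p (hpE h)
  · have hpos := hp.card_pos
    obtain ⟨u, rfl⟩ := Finset.card_eq_one.1 (show p.card = 1 by omega)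
    simp

/-- combining a point of `S_{G₁}` and a point of `S_{G₂}` into a point
of `S_G`. -/
theorem combination_in_multilinear_set
    (V : Finset α) (E : Finset (Finset α)) (hG : IsHypergraph V E)
    (v : α) (hv : IsNestPoint V E v)
    (k : ℕ) (hk : 1 ≤ k) (e : Fin k → Finset α)
    (hchain : ∀ i j : Fin k, i < j → e i ⊂ e j)
    (hEv : ∀ f : Finset α, (f ∈ E ∧ v ∈ f) ↔ ∃ i, f = e i)
    (hPv : ∀ i : Fin k, 2 ≤ ((e i).erase v).card → (e i).erase v ∈ E)
    (z z' : (α ⊕ Finset α) → ℝ)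
    (hz : z ∈ mSet (e ⟨k - 1, by omega⟩)
        (Finset.univ.image e ∪
          (Finset.univ.image fun i => (e i).erase v).filter fun p => 2 ≤ p.card))
    (hz' : z' ∈ mSet (V.erase v) (eraseE E v))
    (hmatch : ∀ i : Fin k, zc z ((e i).erase v) = zc z' ((e i).erase v)) :
    (fun c => if c = Sum.inl v ∨ (∃ i : Fin k, c = Sum.inr (e i)) then z c else z' c)
      ∈ mSet V E := by
  have hmem : ∀ i, e i ∈ E ∧ v ∈ e i := fun i => (hEv _).2 ⟨i, rfl⟩
  have hsub : eraseE E v ⊆ E := eraseE_subset fun f hf hvf hcard => by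
    obtain ⟨i, rfl⟩ := (hEv f).1 ⟨hf, hvf⟩
    exact hPv i hcard
  refine ⟨fun u hu => ?_, fun u hu => ?_, fun f hf => ?_, fun f hf => ?_⟩
  · by_cases huv : u = v
    · subst huv
      simpa using hz.1 u (hmem _).2
    · simpa [huv] using hz'.1 u (Finset.mem_erase.2 ⟨huv, hu⟩)
  · have huv : u ≠ v := fun h => hu (h ▸ hv.1)
    simpa [huv] using hz'.2.1 u fun h => hu (Finset.mem_of_mem_erase h)
  · have hne : ¬ ∃ i, f = e i := fun h => hf ((hEv f).2 h).1
    simpa [hne] using hz'.2.2.1 f fun h => hf (hsub h)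
  · have hprod : ∀ p : Finset α, v ∉ p →
        ∏ u ∈ p, (if (Sum.inl u : α ⊕ Finset α) = Sum.inl v ∨ ∃ i, (Sum.inl u : α ⊕ Finset α) = Sum.inr (e i)
          then z (Sum.inl u) else z' (Sum.inl u)) = ∏ u ∈ p, z' (Sum.inl u) := by
      intro p hvp
      refine Finset.prod_congr rfl fun u hu => ?_
      have huv : u ≠ v := fun h => hvp (h ▸ hu)
      simp [huv]
    by_cases hvf : v ∈ f
    · obtain ⟨i, rfl⟩ := (hEv f).1 ⟨hf, hvf⟩
      have hne : ((e i).erase v).Nonempty := by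
        rw [← Finset.card_pos, Finset.card_erase_of_mem hvf]
        have := hG.2 _ hf
        omega
      have hprod_eq : ∏ u ∈ (e i).erase v, z (Sum.inl u)
          = ∏ u ∈ (e i).erase v, z' (Sum.inl u) := by
        rw [← zc_eq_prod_s1 hz hne fun h => Finset.mem_union_right _ (Finset.mem_filter.2
            ⟨Finset.mem_image_of_mem _ (Finset.mem_univ i), h⟩),
          ← zc_eq_prod_s1 hz' hne (erase_mem_eraseE hf), hmatch i]
      have hzi := hz.2.2.2 (e i)
        (Finset.mem_union_left _ (Finset.mem_image_of_mem _ (Finset.mem_univ i)))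
      rw [← Finset.mul_prod_erase _ _ hvf, hprod_eq] at hzi
      rw [← Finset.mul_prod_erase _ _ hvf, hprod _ (Finset.notMem_erase v _)]
      simpa using hzi
    · have hne : ¬ ∃ i, f = e i := fun h => hvf ((hEv f).2 h).2
      have herase := Finset.erase_eq_of_notMem hvf
      have hfE : f ∈ eraseE E v := by
        have := erase_mem_eraseE (v := v) hf
        rw [herase] at this
        exact this (hG.2 f hf)
      rw [hprod f hvf]
      simpa [hne] using hz'.2.2.2 f hfE
end

section
/- Let G be a hypergraph, let v_1, …, v_s be a nest point sequence of G, and let G' be the expansion of G w.r.t. v_1, …, v_s. Then G' is expanded w.r.t. v_1, …, v_s. -/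
open BigOperators

variable {α : Type*} [DecidableEq α]

theorem mem_eraseListE {E : Finset (Finset α)} (hE : ∀ e ∈ E, 2 ≤ e.card) {l : List α}
    {p : Finset α} :
    p ∈ eraseListE E l ↔ ∃ e ∈ E, p = e \ l.toFinset ∧ 2 ≤ p.card := by
  induction l generalizing E with
  | nil =>
    constructor
    · intro hp
      exact ⟨p, hp, by simp, hE p hp⟩
    · rintro ⟨e, he, rfl, -⟩
      simpa [eraseListE] using he
  | cons a l ih =>
    have hsdiff (e : Finset α) : e.erase a \ l.toFinset = e \ (a :: l).toFinset := by
      ext x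
      simp only [Finset.mem_sdiff, Finset.mem_erase, List.mem_toFinset, List.mem_cons]
      tauto
    have hE' : ∀ e ∈ eraseE E a, 2 ≤ e.card := fun e he => (Finset.mem_filter.1 he).2
    refine (ih hE').trans ⟨?_, ?_⟩
    · rintro ⟨f, hf, rfl, hcard⟩
      obtain ⟨e, he, rfl⟩ := Finset.mem_image.1 (Finset.mem_filter.1 hf).1
      exact ⟨e, he, hsdiff e, hcard⟩
    · rintro ⟨e, he, rfl, hcard⟩
      rw [← hsdiff] at hcard ⊢
      exact ⟨e.erase a, Finset.mem_filter.2 ⟨Finset.mem_image_of_mem _ he,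
        hcard.trans (Finset.card_le_card Finset.sdiff_subset)⟩, rfl, hcard⟩

theorem mem_expansionE {E : Finset (Finset α)} (hE : ∀ e ∈ E, 2 ≤ e.card) {l : List α}
    {p : Finset α} :
    p ∈ expansionE E l ↔
      ∃ e ∈ E, ∃ i ≤ l.length, p = e \ (l.take i).toFinset ∧ 2 ≤ p.card := by
  simp only [expansionE, Finset.mem_union, Finset.mem_biUnion, Finset.mem_filter,
    Finset.mem_image, Finset.mem_range]
  constructor
  · rintro (hp | ⟨e, he, ⟨i, hi, rfl⟩, hcard⟩)
    · exact ⟨p, hp, 0, Nat.zero_le _, by simp, hE p hp⟩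
    · exact ⟨e, he, i + 1, hi, rfl, hcard⟩
  · rintro ⟨e, he, _ | i, hi, rfl, hcard⟩
    · exact Or.inl (by simpa using he)
    · exact Or.inr ⟨e, he, ⟨i, hi, rfl⟩, hcard⟩

theorem sdiff_take_sdiff_take (e : Finset α) (l : List α) (i j : ℕ) :
    (e \ (l.take i).toFinset) \ (l.take j).toFinset = e \ (l.take (max i j)).toFinset := by
  have hmono {m n : ℕ} (h : m ≤ n) : (l.take m).toFinset ⊆ (l.take n).toFinset :=
    fun x hx => List.mem_toFinset.2
      ((List.take_sublist_take_left h).subset (List.mem_toFinset.1 hx))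
  rw [sdiff_sdiff_left, Finset.sup_eq_union]
  rcases le_total i j with h | h
  · rw [max_eq_right h, Finset.union_eq_right.2 (hmono h)]
  · rw [max_eq_left h, Finset.union_eq_left.2 (hmono h)]

/-- After removing the first `i` nodes, the edges of the expansion that contain the next node
are edges of the original hypergraph with those nodes removed. -/
theorem mem_eraseListE_of_mem_expansionE {E : Finset (Finset α)} (hE : ∀ e ∈ E, 2 ≤ e.card)
    {l : List α} {p : Finset α} (i : Fin l.length)
    (hp : p ∈ eraseListE (expansionE E l) (l.take i)) (hi : l.get i ∈ p) :
    p ∈ eraseListE E (l.take i) := by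
  have hE' : ∀ e ∈ expansionE E l, 2 ≤ e.card := fun e he => by
    obtain ⟨-, -, -, -, -, hcard⟩ := (mem_expansionE hE).1 he
    exact hcard
  obtain ⟨f, hf, rfl, hcard⟩ := (mem_eraseListE hE').1 hp
  obtain ⟨e, he, k, -, rfl, -⟩ := (mem_expansionE hE).1 hf
  have hk : k ≤ i := by
    by_contra! hlt
    refine (Finset.mem_sdiff.1 (Finset.mem_sdiff.1 hi).1).2 (List.mem_toFinset.2 ?_)
    exact List.mem_take_iff_getElem.2 ⟨i, lt_min hlt i.2, rfl⟩
  refine (mem_eraseListE hE).2 ⟨e, he, ?_, hcard⟩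
  rw [sdiff_take_sdiff_take, max_eq_right hk]

/-- the expansion of a hypergraph w.r.t. a nest point sequence is expanded
w.r.t. that sequence. -/
theorem expansion_is_expanded
    (V : Finset α) (E : Finset (Finset α)) (hG : IsHypergraph V E)
    (l : List α) (h : IsNestPointSeq V E l) :
    IsExpanded V (expansionE E l) l := by
  refine ⟨⟨h.1, fun i => ⟨(h.2 i).1, fun e he hie f hf hif => ?_⟩⟩, fun f hf i hi hcard => ?_⟩
  · exact (h.2 i).2 e (mem_eraseListE_of_mem_expansionE hG.2 i he hie) hie
      f (mem_eraseListE_of_mem_expansionE hG.2 i hf hif) hif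
  · obtain ⟨e, he, k, hk, rfl, -⟩ := (mem_expansionE hG.2).1 hf
    exact (mem_expansionE hG.2).2
      ⟨e, he, max k i, max_le hk hi, sdiff_take_sdiff_take e l k i, hcard⟩
end

section
/- Let G = (V,E) be a hypergraph expanded w.r.t. v_1, …, v_s. Let e ∈ E with e ∩ {v_1, …, v_s} ≠ ∅, and let v_i be the first node in the sequence v_1, …, v_s contained in e. Then e \ {v_i} ∈ E whenever |e \ {v_i}| ≥ 2. Furthermore, if there exists at least one edge of E strictly contained in e and containing v_i, then among all such edges there is exactly one edge f of maximum cardinality, and f \ {v_i} ∈ E whenever |f| ≥ 3. -/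
open BigOperators

variable {α : Type*} [DecidableEq α]

/-- An edge that avoids all the removed nodes survives their removal. -/
theorem mem_eraseListE_of_forall_notMem {E : Finset (Finset α)} {e : Finset α} {l : List α}
    (he : e ∈ E) (hcard : 2 ≤ e.card) (hl : ∀ x ∈ l, x ∉ e) : e ∈ eraseListE E l := by
  induction l generalizing E with
  | nil => exact he
  | cons a l ih =>
    refine ih (E := eraseE E a) ?_ fun x hx => hl x (List.mem_cons_of_mem _ hx)
    exact Finset.mem_filter.2 ⟨Finset.mem_image.2
      ⟨e, he, Finset.erase_eq_of_notMem (hl a List.mem_cons_self)⟩, hcard⟩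

theorem sdiff_take_succ_eq_erase {l : List α} {e : Finset α} (i : Fin l.length)
    (h : ∀ x ∈ l.take i.1, x ∉ e) :
    e \ (l.take (i.1 + 1)).toFinset = e.erase (l.get i) := by
  ext x
  have hx := h x
  simp only [List.take_add_one, List.getElem?_eq_getElem i.2, Option.toList_some,
    Finset.mem_sdiff, List.mem_toFinset, List.mem_append, List.mem_singleton, Finset.mem_erase,
    List.get_eq_getElem]
  tauto

/-- In an expanded hypergraph, an edge remains an edge after deleting the first node of the
sequence that it contains. -/
theorem IsExpanded.erase_mem {V : Finset α} {E : Finset (Finset α)} {l : List α}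
    (hexp : IsExpanded V E l) {e : Finset α} (he : e ∈ E) (i : Fin l.length)
    (h : ∀ x ∈ l.take i.1, x ∉ e) (hcard : 2 ≤ (e.erase (l.get i)).card) :
    e.erase (l.get i) ∈ E := by
  rw [← sdiff_take_succ_eq_erase i h] at hcard ⊢
  exact hexp.2 e he _ i.2 hcard

/-- structure of expanded hypergraphs. -/
theorem expanded_hypergraph_structure
    (V : Finset α) (E : Finset (Finset α)) (hG : IsHypergraph V E)
    (l : List α) (hexp : IsExpanded V E l)
    (e : Finset α) (he : e ∈ E)
    (i : Fin l.length) (hi : l.get i ∈ e)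
    (hfirst : ∀ j : Fin l.length, j < i → l.get j ∉ e) :
    (2 ≤ (e.erase (l.get i)).card → e.erase (l.get i) ∈ E) ∧
      ((∃ g ∈ E, g ⊂ e ∧ l.get i ∈ g) →
        ∃ f ∈ E, f ⊂ e ∧ l.get i ∈ f ∧
          (∀ g ∈ E, g ⊂ e → l.get i ∈ g → g.card ≤ f.card) ∧
          (∀ g ∈ E, g ⊂ e → l.get i ∈ g → g.card = f.card → g = f) ∧
          (3 ≤ f.card → f.erase (l.get i) ∈ E)) := by
  have htake : ∀ x ∈ l.take i.1, x ∉ e := by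
    intro x hx
    obtain ⟨j, hj, rfl⟩ := List.mem_take_iff_getElem.1 hx
    exact hfirst ⟨j, by omega⟩ (Fin.lt_def.2 (by simp only; omega))
  refine ⟨hexp.erase_mem he i htake, ?_⟩
  rintro ⟨g, hgE, hge, hig⟩
  obtain ⟨f, hf, hmax⟩ :=
    (E.filter fun f => f ⊂ e ∧ l.get i ∈ f).exists_max_image Finset.card
      ⟨g, Finset.mem_filter.2 ⟨hgE, hge, hig⟩⟩
  obtain ⟨hfE, hfe, hif⟩ := Finset.mem_filter.1 hf
  have hsurvives : ∀ p ∈ E, p ⊂ e → p ∈ eraseListE E (l.take i.1) := fun p hp hpe =>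
    mem_eraseListE_of_forall_notMem hp (hG.2 p hp) fun x hx hxp => htake x hx (hpe.1 hxp)
  refine ⟨f, hfE, hfe, hif, fun p hp hpe hip => hmax p (Finset.mem_filter.2 ⟨hp, hpe, hip⟩),
    fun p hp hpe hip hcard => ?_, fun hcard => ?_⟩
  · rcases (hexp.1.2 i).2 p (hsurvives p hp hpe) hip f (hsurvives f hfE hfe) hif with h | h
    · exact Finset.eq_of_subset_of_card_le h hcard.ge
    · exact (Finset.eq_of_subset_of_card_le h hcard.le).symm
  · refine hexp.erase_mem hfE i (fun x hx hxf => htake x hx (hfe.1 hxf)) ?_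
    rw [Finset.card_erase_of_mem hif]
    omega
end
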